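/- Let y > 1 be fixed and let r(n) denote the unique positive solution t of t·(e^t + √y) = n·√y·log y. Then n·e^{−r(n)} ~ (log n)/(√y·log y) as n → ∞. -/

import Mathlib

open Filter Topology in
theorem tendsto_one_add_mul_exp_neg (s : ℝ) :
    Tendsto (fun t : ℝ => 1 + s * Real.exp (-t)) atTop (𝓝 1) := by
  simpa using (Real.tendsto_exp_neg_atTop_nhds_zero.const_mul s).const_add 1

open Filter Topology in
theorem tendsto_log_mul_exp_add_div_self {s c : ℝ} (hs : 0 ≤ s) (hc : 0 < c) :
    Tendsto (fun t : ℝ => Real.log (t * (Real.exp t + s) / c) / t) atTop (𝓝 1) := by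
  have h_log : Tendsto (fun t : ℝ => Real.log t / t) atTop (𝓝 0) :=
    Real.isLittleO_log_id_atTop.tendsto_div_nhds_zero
  have h_rest : Tendsto (fun t : ℝ => (Real.log (1 + s * Real.exp (-t)) - Real.log c) / t)
      atTop (𝓝 0) :=
    (((tendsto_one_add_mul_exp_neg s).log one_ne_zero).sub_const (Real.log c)).div_atTop
      tendsto_id
  have h_sum := (h_log.const_add 1).add h_rest
  rw [add_zero, add_zero] at h_sum
  refine h_sum.congr' ?_
  filter_upwards [eventually_gt_atTop 0] with t ht
  have h_pos : 0 < 1 + s * Real.exp (-t) := by positivity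
  have h_factor : Real.exp t + s = Real.exp t * (1 + s * Real.exp (-t)) := by
    rw [Real.exp_neg]
    field_simp
  rw [h_factor, Real.log_div (by positivity) hc.ne', Real.log_mul ht.ne' (by positivity),
    Real.log_mul (Real.exp_pos t).ne' h_pos.ne', Real.log_exp]
  field_simp
  ring

open Filter in
theorem tendsto_atTop_of_mul_exp_add_eq {s c : ℝ} (hs : 0 ≤ s) (hc : 0 < c) {r : ℕ → ℝ}
    (hr : ∀ n : ℕ, 0 < n → 0 < r n ∧ r n * (Real.exp (r n) + s) = n * c) :
    Tendsto r atTop atTop := by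
  refine tendsto_atTop.2 fun B => ?_
  have h_lin : Tendsto (fun n : ℕ => (n : ℝ) * c) atTop atTop :=
    tendsto_natCast_atTop_atTop.atTop_mul_const hc
  filter_upwards [h_lin.eventually_gt_atTop (B * (Real.exp B + s)), eventually_gt_atTop 0]
    with n hn hn0
  obtain ⟨h_pos, h_eq⟩ := hr n hn0
  by_contra! h_lt
  have h_le : r n * (Real.exp (r n) + s) ≤ B * (Real.exp B + s) :=
    mul_le_mul h_lt.le (by gcongr) (by positivity) (h_pos.trans h_lt).le
  linarith

/-- For fixed `y > 1`, the unique positive solution `r n` of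
`t * (exp t + √y) = n * √y * log y` satisfies
`n * exp (−r n) ~ log n / (√y * log y)` as `n → ∞`. -/
theorem n_exp_neg_r_asymptotic (y : ℝ) (hy : 1 < y) (r : ℕ → ℝ)
    (hr : ∀ n : ℕ, 0 < n →
      0 < r n ∧ r n * (Real.exp (r n) + Real.sqrt y) = n * Real.sqrt y * Real.log y) :
    Filter.Tendsto
      (fun n : ℕ => (n : ℝ) * Real.exp (-(r n)) / (Real.log n / (Real.sqrt y * Real.log y)))
      Filter.atTop (nhds 1) := by
  have hs : 0 ≤ Real.sqrt y := Real.sqrt_nonneg y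
  have hc : 0 < Real.sqrt y * Real.log y :=
    mul_pos (Real.sqrt_pos.2 (by linarith)) (Real.log_pos hy)
  simp only [mul_assoc _ (Real.sqrt y) (Real.log y)] at hr
  generalize Real.sqrt y * Real.log y = c at hc hr ⊢
  generalize Real.sqrt y = s at hs hr
  have h_quot := ((tendsto_one_add_mul_exp_neg s).div
    (tendsto_log_mul_exp_add_div_self hs hc) one_ne_zero).comp
    (tendsto_atTop_of_mul_exp_add_eq hs hc hr)
  rw [div_one] at h_quot
  refine h_quot.congr' ?_
  filter_upwards [Filter.eventually_gt_atTop 0] with n hn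
  obtain ⟨h_pos, h_eq⟩ := hr n hn
  have h_num : r n * (1 + s * Real.exp (-r n)) = n * Real.exp (-r n) * c := by
    have h_one : Real.exp (r n) * Real.exp (-r n) = 1 := by
      rw [← Real.exp_add, add_neg_cancel, Real.exp_zero]
    linear_combination Real.exp (-r n) * h_eq - r n * h_one
  simp only [Function.comp_apply, Pi.div_apply]
  rw [h_eq, mul_div_cancel_right₀ _ hc.ne', div_div_eq_mul_div, div_div_eq_mul_div, ← h_num,
    mul_comm]
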